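/- Let D be a database and C a consistent set of constraints with H_B(C) ⊆ H_B(D). Then every C-repair of D is a preferred answer set of the ordered program P(D,C), which consists of the n-rules {¬a ← | a ∈ D}, the d-rules {a ← | a ∈ D}, and the c-rules {a ← ¬(A \ {a}) | (∨_{a∈A} a) ∈ C, a ∈ A}, ordered c-rules < d-rules < n-rules. -/

import Mathlib

namespace ASP

/-- A literal is an atom `a` or a negated atom `¬ a`. -/
inductive Lit (α : Type) : Type where
  | pos (a : α)
  | neg (a : α)
deriving DecidableEq

/-- Classical negation of a literal. -/
def Lit.negate {α : Type} : Lit α → Lit α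
  | .pos a => .neg a
  | .neg a => .pos a

/-- The atom underlying a literal. -/
def Lit.atom {α : Type} : Lit α → α
  | .pos a => a
  | .neg a => a

/-- A rule of a simple logic program: a head which is a literal or absent
(a constraint), and a finite set of literals as body. -/
structure Rule (α : Type) [DecidableEq α] : Type where
  head : Option (Lit α)
  body : Finset (Lit α)

variable {α : Type} [DecidableEq α]

/-- A set of literals is consistent if it contains no complementary pair. -/
def Consistent (I : Set (Lit α)) : Prop :=
  ∀ a : α, ¬(Lit.pos a ∈ I ∧ Lit.neg a ∈ I)

/-- The Herbrand base of a program: all atoms occurring in it. -/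
def herbrand (P : Set (Rule α)) : Set α :=
  {a | ∃ r ∈ P, (∃ l, r.head = some l ∧ l.atom = a) ∨ (∃ l ∈ r.body, l.atom = a)}

/-- An interpretation of `P`: a consistent set of literals over the Herbrand base of `P`. -/
def IsInterp (P : Set (Rule α)) (I : Set (Lit α)) : Prop :=
  Consistent I ∧ ∀ l ∈ I, l.atom ∈ herbrand P

/-- A rule `a ← β` is satisfied by `I` if `a ∈ I` whenever `β ⊆ I`;
a constraint `← β` is satisfied if its body is not contained in `I`. -/
def Satisfied (I : Set (Lit α)) (r : Rule α) : Prop :=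
  ↑r.body ⊆ I → ∃ l, r.head = some l ∧ l ∈ I

/-- A rule is applied w.r.t. `I` if its body holds and its head literal is in `I`. -/
def Applied (I : Set (Lit α)) (r : Rule α) : Prop :=
  ↑r.body ⊆ I ∧ ∃ l, r.head = some l ∧ l ∈ I

/-- A rule `a ← β` is defeated w.r.t. `P` and `I` iff `P` contains an applied
competing rule `¬a ← β'`. -/
def Defeated (P : Set (Rule α)) (I : Set (Lit α)) (r : Rule α) : Prop :=
  ∃ l, r.head = some l ∧ ∃ r' ∈ P, r'.head = some l.negate ∧ Applied I r'

/-- The reduct of `P` w.r.t. `I`: the rules of `P` satisfied by `I`. -/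
def reduct (P : Set (Rule α)) (I : Set (Lit α)) : Set (Rule α) :=
  {r ∈ P | Satisfied I r}

/-- `star R` is the unique minimal model of `R` viewed as a positive program
(negative literals treated as fresh atoms; constraints never fire their head). -/
def star (R : Set (Rule α)) : Set (Lit α) :=
  ⋂₀ {J : Set (Lit α) | ∀ r ∈ R, ↑r.body ⊆ J → ∀ l, r.head = some l → l ∈ J}

/-- An interpretation is founded iff `(P_I)* = I`. -/
def Founded (P : Set (Rule α)) (I : Set (Lit α)) : Prop :=
  star (reduct P I) = I

/-- A founded interpretation `M` is an extended answer set of `P` iff every rule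
of `P` is satisfied or defeated w.r.t. `M`. -/
def ExtAnswerSet (P : Set (Rule α)) (M : Set (Lit α)) : Prop :=
  IsInterp P M ∧ Founded P M ∧ ∀ r ∈ P, Satisfied M r ∨ Defeated P M r

/-- An answer set of a program without negation as failure: a minimal
interpretation satisfying all rules of the program. -/
def IsAnswerSet (P : Set (Rule α)) (M : Set (Lit α)) : Prop :=
  IsInterp P M ∧ (∀ r ∈ P, Satisfied M r) ∧
    ∀ J, IsInterp P J → (∀ r ∈ P, Satisfied J r) → ¬J ⊂ M


section OLP

variable {α : Type} [DecidableEq α]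

/-- `R₁ ⊑ R₂` for sets of rules: every rule in `R₂ \ R₁` is countered by a
`<`-smaller rule in `R₁ \ R₂`. -/
def RuleSq (lt : Rule α → Rule α → Prop) (R₁ R₂ : Set (Rule α)) : Prop :=
  ∀ r₂ ∈ R₂ \ R₁, ∃ r₁ ∈ R₁ \ R₂, lt r₁ r₂

/-- `M₁ ⊑ M₂` for (extended) answer sets of an ordered program: the induced
order on their reducts. -/
def ASSq (P : Set (Rule α)) (lt : Rule α → Rule α → Prop)
    (M₁ M₂ : Set (Lit α)) : Prop :=
  RuleSq lt (reduct P M₁) (reduct P M₂)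

/-- `M₁ ⊏ M₂` iff `M₁ ⊑ M₂` and not `M₂ ⊑ M₁`. -/
def ASLt (P : Set (Rule α)) (lt : Rule α → Rule α → Prop)
    (M₁ M₂ : Set (Lit α)) : Prop :=
  ASSq P lt M₁ M₂ ∧ ¬ ASSq P lt M₂ M₁

/-- An answer set is proper iff it satisfies all `<`-minimal rules of `P`. -/
def ProperAS (P : Set (Rule α)) (lt : Rule α → Rule α → Prop)
    (M : Set (Lit α)) : Prop :=
  ∀ r ∈ P, (∀ r' ∈ P, ¬ lt r' r) → Satisfied M r

/-- A preferred answer set of the ordered program `(P, lt)`: an extended answer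
set of `P` that is `⊑`-minimal among the extended answer sets of `P`. -/
def PreferredAS (P : Set (Rule α)) (lt : Rule α → Rule α → Prop)
    (M : Set (Lit α)) : Prop :=
  ExtAnswerSet P M ∧ ∀ N, ExtAnswerSet P N → ¬ ASLt P lt N M

end OLP

section Databases

variable {α : Type} [DecidableEq α]

/-- The Herbrand base of a set of constraints (finite sets of literals,
interpreted as disjunctions). -/
def hbC (C : Set (Finset (Lit α))) : Set α :=
  {a | ∃ A ∈ C, ∃ l ∈ A, l.atom = a}

/-- A set of literals classically models the constraints `C`: it makes every
disjunction true. -/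
def ModelsC (D : Set (Lit α)) (C : Set (Finset (Lit α))) : Prop :=
  ∀ A ∈ C, ∃ l ∈ A, l ∈ D

/-- A database `D` is consistent with `C`: `D` is a database whose Herbrand
base covers that of `C` and `D` is a classical model of `C`. -/
def DBConsistentWith (C : Set (Finset (Lit α))) (D : Set (Lit α)) : Prop :=
  Consistent D ∧ hbC C ⊆ Lit.atom '' D ∧ ModelsC D C

/-- A set of constraints is consistent iff some database is consistent with
it. -/
def CConsistent (C : Set (Finset (Lit α))) : Prop :=
  ∃ D : Set (Lit α), DBConsistentWith C D

/-- `D'` is a `C`-repair of `D`: a database over the same Herbrand base as `D`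
that models `C` and is `≤_D`-minimal, where `D₁ ≤_D D₂` iff `D₁ \ D ⊆ D₂ \ D`. -/
def CRepair (D : Set (Lit α)) (C : Set (Finset (Lit α))) (D' : Set (Lit α)) : Prop :=
  Consistent D' ∧ Lit.atom '' D' = Lit.atom '' D ∧ ModelsC D' C ∧
    ∀ D'' : Set (Lit α), Consistent D'' → Lit.atom '' D'' = Lit.atom '' D →
      ModelsC D'' C → D'' \ D ⊆ D' \ D → D'' = D'

/-- The `n`-rules `{¬a ← | a ∈ D}` of `P(D,C)`. -/
def nRules (D : Set (Lit α)) : Set (Rule α) :=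
  {r | ∃ l ∈ D, r = ⟨some l.negate, ∅⟩}

/-- The `d`-rules `{a ← | a ∈ D}` of `P(D,C)`. -/
def dRules (D : Set (Lit α)) : Set (Rule α) :=
  {r | ∃ l ∈ D, r = ⟨some l, ∅⟩}

/-- The `c`-rules `{a ← ¬(A \ {a}) | (∨_{a∈A} a) ∈ C, a ∈ A}` of `P(D,C)`. -/
def cRules (C : Set (Finset (Lit α))) : Set (Rule α) :=
  {r | ∃ A ∈ C, ∃ l ∈ A, r = ⟨some l, (A.erase l).image Lit.negate⟩}

/-- The ordered version `P(D,C)` of a database `D` w.r.t. constraints `C`. -/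
def PDC (D : Set (Lit α)) (C : Set (Finset (Lit α))) : Set (Rule α) :=
  cRules C ∪ dRules D ∪ nRules D

/-- The order of `P(D,C)`: `c`-rules < `d`-rules < `n`-rules. -/
def PDClt (D : Set (Lit α)) (C : Set (Finset (Lit α))) :
    Rule α → Rule α → Prop :=
  fun r₁ r₂ =>
    (r₁ ∈ cRules C ∧ (r₂ ∈ dRules D ∨ r₂ ∈ nRules D)) ∨
    (r₁ ∈ dRules D ∧ r₂ ∈ nRules D)

end Databases

@[simp] theorem Lit.negate_negate {α : Type} (l : Lit α) : l.negate.negate = l := by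
  cases l <;> rfl

@[simp] theorem Lit.atom_negate {α : Type} (l : Lit α) : l.negate.atom = l.atom := by
  cases l <;> rfl

theorem Lit.eq_or_eq_negate_of_atom_eq {α : Type} {l m : Lit α} (h : l.atom = m.atom) :
    l = m ∨ l = m.negate := by
  cases l <;> cases m <;> simp_all [Lit.atom, Lit.negate]

theorem Consistent.negate_notMem {α : Type} {I : Set (Lit α)} (hI : Consistent I)
    {l : Lit α} (hl : l ∈ I) : l.negate ∉ I := by
  intro hn
  cases l with
  | pos a => exact hI a ⟨hl, hn⟩
  | neg a => exact hI a ⟨hn, hl⟩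

theorem mem_or_negate_mem_of_atom_mem {α : Type} {I : Set (Lit α)} {l : Lit α}
    (h : l.atom ∈ Lit.atom '' I) : l ∈ I ∨ l.negate ∈ I := by
  obtain ⟨m, hm, hml⟩ := h
  rcases Lit.eq_or_eq_negate_of_atom_eq hml with rfl | rfl
  · exact Or.inl hm
  · exact Or.inr hm

theorem satisfied_fact {I : Set (Lit α)} {l : Lit α} :
    Satisfied I ⟨some l, ∅⟩ ↔ l ∈ I := by
  simp [Satisfied]

theorem satisfied_of_mem_cRules {C : Set (Finset (Lit α))} {I : Set (Lit α)} (hI : Consistent I)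
    (hM : ModelsC I C) {r : Rule α} (hr : r ∈ cRules C) : Satisfied I r := by
  obtain ⟨A, hA, l, hl, rfl⟩ := hr
  intro hbody
  obtain ⟨m, hmA, hmI⟩ := hM A hA
  by_cases hml : m = l
  · exact ⟨l, rfl, hml ▸ hmI⟩
  · have hmem : m.negate ∈ (A.erase l).image Lit.negate :=
      Finset.mem_image_of_mem _ (Finset.mem_erase.2 ⟨hml, hmA⟩)
    exact absurd (hbody (Finset.mem_coe.2 hmem)) (hI.negate_notMem hmI)

/-- A total interpretation satisfying the `c`-rules of nonempty constraints models them. -/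
theorem modelsC_of_satisfied_cRules {C : Set (Finset (Lit α))} {I : Set (Lit α)}
    (hne : ∀ A ∈ C, A.Nonempty) (htot : hbC C ⊆ Lit.atom '' I)
    (hsat : ∀ r ∈ cRules C, Satisfied I r) : ModelsC I C := by
  intro A hA
  by_contra! hcon
  obtain ⟨l, hl⟩ := hne A hA
  obtain ⟨m, hm, hmI⟩ := hsat _ ⟨A, hA, l, hl, rfl⟩ (by
    intro x hx
    obtain ⟨y, hy, rfl⟩ := Finset.mem_image.1 (Finset.mem_coe.1 hx)
    have hyA := Finset.mem_of_mem_erase hy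
    exact (mem_or_negate_mem_of_atom_mem (htot ⟨A, hA, y, hyA, rfl⟩)).resolve_left (hcon y hyA))
  exact hcon l hl (Option.some.inj hm ▸ hmI)

theorem fact_mem_PDC {D : Set (Lit α)} (C : Set (Finset (Lit α))) {l : Lit α}
    (h : l.atom ∈ Lit.atom '' D) : (⟨some l, ∅⟩ : Rule α) ∈ PDC D C := by
  rcases mem_or_negate_mem_of_atom_mem h with h | h
  · exact Or.inl (Or.inr ⟨l, h, rfl⟩)
  · exact Or.inr ⟨l.negate, h, by simp⟩

theorem herbrand_PDC {D : Set (Lit α)} {C : Set (Finset (Lit α))}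
    (hCD : hbC C ⊆ Lit.atom '' D) : herbrand (PDC D C) = Lit.atom '' D := by
  apply Set.Subset.antisymm
  · rintro a ⟨r, ((⟨A, hA, l, hl, rfl⟩ | ⟨l, hl, rfl⟩) | ⟨l, hl, rfl⟩), h⟩
    · rcases h with ⟨m, hm, rfl⟩ | ⟨m, hm, rfl⟩
      · cases hm
        exact hCD ⟨A, hA, l, hl, rfl⟩
      · obtain ⟨y, hy, rfl⟩ := Finset.mem_image.1 hm
        exact hCD ⟨A, hA, y, Finset.mem_of_mem_erase hy, by simp⟩
    · rcases h with ⟨m, hm, rfl⟩ | ⟨m, hm, rfl⟩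
      · cases hm
        exact ⟨l, hl, rfl⟩
      · simp at hm
    · rcases h with ⟨m, hm, rfl⟩ | ⟨m, hm, rfl⟩
      · cases hm
        exact ⟨l, hl, by simp⟩
      · simp at hm
  · rintro _ ⟨l, hl, rfl⟩
    exact ⟨_, fact_mem_PDC C ⟨l, hl, rfl⟩, Or.inl ⟨l, rfl, rfl⟩⟩

theorem extAnswerSet_PDC_of_modelsC {D : Set (Lit α)} {C : Set (Finset (Lit α))}
    (hCD : hbC C ⊆ Lit.atom '' D) {R : Set (Lit α)} (hcons : Consistent R)
    (hat : Lit.atom '' R = Lit.atom '' D) (hM : ModelsC R C) :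
    ExtAnswerSet (PDC D C) R := by
  have hfact : ∀ l : Lit α, l.atom ∈ Lit.atom '' D →
      Satisfied R ⟨some l, ∅⟩ ∨ Defeated (PDC D C) R ⟨some l, ∅⟩ := by
    intro l hl
    rcases mem_or_negate_mem_of_atom_mem (hat ▸ hl) with h | h
    · exact Or.inl (satisfied_fact.2 h)
    · exact Or.inr ⟨l, rfl, ⟨some l.negate, ∅⟩, fact_mem_PDC C (by simpa using hl), rfl,
        by simp, l.negate, rfl, h⟩
  refine ⟨⟨hcons, ?_⟩, ?_, ?_⟩
  · intro l hl
    rw [herbrand_PDC hCD, ← hat]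
    exact ⟨l, hl, rfl⟩
  · apply Set.Subset.antisymm
    · apply Set.sInter_subset_of_mem
      rintro r ⟨-, hr⟩ hb l hl
      obtain ⟨m, hm, hmR⟩ := hr hb
      rw [hl] at hm
      exact Option.some.inj hm ▸ hmR
    · intro l hl J hJ
      exact hJ ⟨some l, ∅⟩ ⟨fact_mem_PDC C (hat ▸ ⟨l, hl, rfl⟩), satisfied_fact.2 hl⟩
        (by simp) l rfl
  · rintro r ((hr | ⟨l, hl, rfl⟩) | ⟨l, hl, rfl⟩)
    · exact Or.inl (satisfied_of_mem_cRules hcons hM hr)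
    · exact hfact l ⟨l, hl, rfl⟩
    · exact hfact l.negate ⟨l, hl, by simp⟩

/-- Extended answer sets of `P(D,C)` are databases over the Herbrand base of `D`. -/
theorem ExtAnswerSet.atom_image_eq {D : Set (Lit α)} {C : Set (Finset (Lit α))}
    (hCD : hbC C ⊆ Lit.atom '' D) {N : Set (Lit α)} (hN : ExtAnswerSet (PDC D C) N) :
    Lit.atom '' N = Lit.atom '' D := by
  apply Set.Subset.antisymm
  · rintro _ ⟨l, hl, rfl⟩
    exact herbrand_PDC hCD ▸ hN.1.2 l hl
  · rintro _ ⟨l, hl, rfl⟩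
    rcases hN.2.2 ⟨some l, ∅⟩ (fact_mem_PDC C ⟨l, hl, rfl⟩) with h | h
    · exact ⟨l, satisfied_fact.1 h, rfl⟩
    · obtain ⟨m, hm, r, -, hrh, -, k, hk, hkN⟩ := h
      cases hm
      rw [hrh] at hk
      cases hk
      exact ⟨_, hkN, by simp⟩

/-- Let `D` be a database and `C` a consistent set of constraints
with `H_B(C) ⊆ H_B(D)`.  Then every `C`-repair of `D` is a preferred answer set
of the ordered program `P(D,C)`. -/
theorem cRepair_is_preferred_PDC
    {α : Type} [DecidableEq α]
    (D : Set (Lit α)) (hD : Consistent D)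
    (C : Set (Finset (Lit α))) (hC : CConsistent C)
    (hCD : hbC C ⊆ Lit.atom '' D)
    (R : Set (Lit α)) (hR : CRepair D C R) :
    PreferredAS (PDC D C) (PDClt D C) R := by
  obtain ⟨hcons, hat, hM, hmin⟩ := hR
  have hRc : ∀ r ∈ cRules C, Satisfied R r := fun r => satisfied_of_mem_cRules hcons hM
  refine ⟨extAnswerSet_PDC_of_modelsC hCD hcons hat hM, ?_⟩
  rintro N hN ⟨hNR, hRN⟩
  have hNat := hN.atom_image_eq hCD
  -- A `c`-rule violated by `N` would counter every rule that only `N` satisfies.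
  have hNc : ∀ r ∈ cRules C, Satisfied N r := by
    intro r hr
    by_contra hns
    refine hRN fun r₂ hr₂ =>
      ⟨r, ⟨⟨Or.inl (Or.inl hr), hRc r hr⟩, fun h => hns h.2⟩, Or.inl ⟨hr, ?_⟩⟩
    rcases hr₂ with ⟨⟨(hc | hd) | hn, -⟩, hnot⟩
    · exact absurd ⟨Or.inl (Or.inl hc), hRc r₂ hc⟩ hnot
    · exact Or.inl hd
    · exact Or.inr hn
  have hNM : ModelsC N C :=
    modelsC_of_satisfied_cRules (fun A hA => (hM A hA).imp fun _ h => h.1) (hNat ▸ hCD) hNc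
  have hsub : N \ D ⊆ R \ D := by
    rintro l ⟨hlN, hlD⟩
    refine ⟨?_, hlD⟩
    by_contra hlR
    have hl : l.atom ∈ Lit.atom '' D := hNat ▸ ⟨l, hlN, rfl⟩
    have hnR := (mem_or_negate_mem_of_atom_mem (hat ▸ hl)).resolve_left hlR
    obtain ⟨r₁, ⟨⟨hr₁, -⟩, hnot⟩, hlt⟩ := hNR ⟨some l.negate, ∅⟩
      ⟨⟨fact_mem_PDC C (by simpa using hl), satisfied_fact.2 hnR⟩,
        fun h => hN.1.1.negate_notMem hlN (satisfied_fact.1 h.2)⟩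
    rcases hlt with ⟨hc, -⟩ | ⟨-, m, hm, heq⟩
    · exact hnot ⟨hr₁, hRc r₁ hc⟩
    · have hneg : l.negate = m.negate := by simpa using heq
      have hlm : l = m := by simpa using congrArg Lit.negate hneg
      exact hlD (hlm ▸ hm)
  obtain rfl := hmin N hN.1.1 hNat hNM hsub
  exact hRN hNR

end ASP
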